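/- Let ρ_X be the standard normal density on ℝ^n, f : ℝ^n → ℝ continuously differentiable with ρ_X-square-integrable partial derivatives, W = [W₁ W₂] orthogonal with W₁ ∈ ℝ^{n×k}, g(y) = ∫_{ℝ^{n−k}} f(W₁y + W₂z) φ_{n−k}(z) dz, and f_g(x) = g(W₁ᵀx). Fix N ≥ 1 and for each y ∈ ℝ^k let Z₁^y, …, Z_N^y be i.i.d. random vectors with density φ_{n−k}, jointly measurable in (y,ω), and set g_N(y,ω) = (1/N) Σ_{j=1}^N f(W₁y + W₂ Z_j^y(ω)). Then the expectation over the sampling randomness of the mean squared error satisfies the identity E[ ∫_{ℝ^k} (g(y) − g_N(y,·))² ρ_Y(y) dy ] = (1/N) ∫_{ℝ^n} (f(x) − f_g(x))² ρ_X(x) dx, where ρ_Y is the density of Y = W₁ᵀX, X ∼ ρ_X. -/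

import Mathlib

open MeasureTheory Matrix Set ProbabilityTheory

/-- The standard normal density on `ℝ^n`. -/
noncomputable def gaussDensity (n : ℕ) (x : Fin n → ℝ) : ℝ :=
  (2 * Real.pi) ^ (-(n : ℝ) / 2) * Real.exp (-(∑ i, x i ^ 2) / 2)

lemma gaussDensity_nonneg (n : ℕ) (x : Fin n → ℝ) : 0 ≤ gaussDensity n x := by
  unfold gaussDensity; positivity

lemma gaussDensity_continuous (n : ℕ) : Continuous (gaussDensity n) := by
  unfold gaussDensity; fun_prop

lemma gaussDensity_eq_prod (n : ℕ) (x : Fin n → ℝ) :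
    gaussDensity n x = ∏ i, gaussianPDFReal 0 1 (x i) := by
  simp only [gaussDensity, gaussianPDFReal, Finset.prod_mul_distrib, ← Real.exp_sum]
  congr 1
  · simp only [NNReal.coe_one, mul_one, Finset.prod_const, Finset.card_univ, Fintype.card_fin]
    rw [Real.sqrt_eq_rpow, ← Real.rpow_neg (by positivity), ← Real.rpow_natCast,
      ← Real.rpow_mul (by positivity)]
    congr 1; ring
  · simp [neg_div, Finset.sum_div]

/-- The standard Gaussian measure on `ℝ^n`. -/
noncomputable def gam (n : ℕ) : Measure (Fin n → ℝ) := Measure.pi fun _ => gaussianReal 0 1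

instance (n : ℕ) : IsProbabilityMeasure (gam n) := by unfold gam; infer_instance

lemma withDensity_eq_gam (n : ℕ) :
    (volume.withDensity fun z => ENNReal.ofReal (gaussDensity n z)) = gam n := by
  symm
  refine Measure.pi_eq fun s hs => ?_
  have key : ∀ i, ∀ t : ℝ, 0 ≤ (s i).indicator (gaussianPDFReal 0 1) t := fun i t =>
    indicator_nonneg (fun t _ => gaussianPDFReal_nonneg 0 1 t) t
  have hint : ∀ i, Integrable ((s i).indicator (gaussianPDFReal 0 1)) := fun i =>
    (integrable_gaussianPDFReal 0 1).indicator (hs i)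
  rw [withDensity_apply _ (MeasurableSet.univ_pi hs), ← lintegral_indicator (MeasurableSet.univ_pi hs)]
  have h1 : (fun x : Fin n → ℝ => (Set.univ.pi s).indicator
      (fun z => ENNReal.ofReal (gaussDensity n z)) x)
      = fun x => ENNReal.ofReal (∏ i, (s i).indicator (gaussianPDFReal 0 1) (x i)) := by
    funext x
    by_cases hx : x ∈ Set.univ.pi s
    · rw [indicator_of_mem hx, gaussDensity_eq_prod]
      congr 1
      exact Finset.prod_congr rfl fun i _ => (indicator_of_mem (hx i (mem_univ i)) _).symm
    · rw [indicator_of_notMem hx]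
      simp only [mem_univ_pi, not_forall] at hx
      obtain ⟨i, hi⟩ := hx
      rw [Finset.prod_eq_zero (Finset.mem_univ i) (indicator_of_notMem hi _)]
      simp
  rw [h1, ← ofReal_integral_eq_lintegral_ofReal]
  · rw [integral_fintype_prod_volume_eq_prod (fun i => (s i).indicator (gaussianPDFReal 0 1)),
      ENNReal.ofReal_prod_of_nonneg (fun i _ => integral_nonneg (key i))]
    refine Finset.prod_congr rfl fun i _ => ?_
    rw [gaussianReal_apply_eq_integral _ (by simp), integral_indicator (hs i)]
  · exact Integrable.fintype_prod (f := fun i => (s i).indicator (gaussianPDFReal 0 1)) hint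
  · exact Filter.Eventually.of_forall fun x => Finset.prod_nonneg fun i _ => key i _

lemma integral_gam (n : ℕ) (h : (Fin n → ℝ) → ℝ) :
    ∫ x, h x * gaussDensity n x = ∫ x, h x ∂(gam n) := by
  rw [← withDensity_eq_gam, integral_withDensity_eq_integral_toReal_smul
    (gaussDensity_continuous n).measurable.ennreal_ofReal (by simp)]
  simp only [ENNReal.toReal_ofReal (gaussDensity_nonneg _ _), smul_eq_mul, mul_comm]

lemma integrable_gam (n : ℕ) (h : (Fin n → ℝ) → ℝ) :
    Integrable (fun x => h x * gaussDensity n x) ↔ Integrable h (gam n) := by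
  rw [← withDensity_eq_gam, integrable_withDensity_iff_integrable_smul'
    (gaussDensity_continuous n).measurable.ennreal_ofReal (by simp)]
  simp only [ENNReal.toReal_ofReal (gaussDensity_nonneg _ _), smul_eq_mul, mul_comm]

lemma gam_eq_map (n : ℕ) : gam n = (stdGaussian (EuclideanSpace ℝ (Fin n))).map
    (EuclideanSpace.equiv (Fin n) ℝ) := by
  rw [← map_pi_eq_stdGaussian, Measure.map_map (by fun_prop) (by fun_prop)]
  exact (Measure.map_id).symm

instance isGaussian_gam (n : ℕ) : IsGaussian (gam n) := by
  rw [gam_eq_map]; infer_instance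

lemma gam_rotation (n : ℕ) (θ : ℝ) :
    ((gam n).prod (gam n)).map (ContinuousLinearMap.rotation θ) = (gam n).prod (gam n) := by
  refine IsGaussian.map_rotation_eq_self_of_forall_strongDual_eq_zero (fun L => ?_) θ
  rw [gam_eq_map, integral_map (by fun_prop) (by fun_prop)]
  exact integral_strongDual_stdGaussian
    (L.comp (EuclideanSpace.equiv (Fin n) ℝ : EuclideanSpace ℝ (Fin n) →L[ℝ] (Fin n → ℝ)))

lemma gam_append (k m : ℕ) : MeasurePreserving (fun p : (Fin k → ℝ) × (Fin m → ℝ) =>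
    (Fin.append p.1 p.2 : Fin (k + m) → ℝ)) ((gam k).prod (gam m)) (gam (k + m)) := by
  have hmeas : Measurable (fun p : (Fin k → ℝ) × (Fin m → ℝ) =>
      (Fin.append p.1 p.2 : Fin (k + m) → ℝ)) := by
    refine measurable_pi_lambda _ fun i => ?_
    refine Fin.addCases (fun i => ?_) (fun i => ?_) i
    · simp only [Fin.append_left]; fun_prop
    · simp only [Fin.append_right]; fun_prop
  refine ⟨hmeas, ?_⟩
  symm
  refine Measure.pi_eq fun s hs => ?_
  rw [Measure.map_apply hmeas (MeasurableSet.univ_pi hs)]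
  have : (fun p : (Fin k → ℝ) × (Fin m → ℝ) =>
      (Fin.append p.1 p.2 : Fin (k + m) → ℝ)) ⁻¹' (Set.univ.pi s) =
      (Set.univ.pi fun i => s (Fin.castAdd m i)) ×ˢ (Set.univ.pi fun i => s (Fin.natAdd k i)) := by
    ext p
    simp only [mem_preimage, mem_univ_pi, mem_prod]
    constructor
    · intro h
      exact ⟨fun i => by simpa using h (Fin.castAdd m i), fun i => by simpa using h (Fin.natAdd k i)⟩
    · rintro ⟨h1, h2⟩ i
      refine Fin.addCases (fun i => ?_) (fun i => ?_) i
      · simpa using h1 i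
      · simpa using h2 i
  rw [this, Measure.prod_prod, gam, gam, Measure.pi_pi, Measure.pi_pi, Fin.prod_univ_add]

lemma gam_orth (n : ℕ) (W : Matrix (Fin n) (Fin n) ℝ) (hW : Wᵀ * W = 1) :
    MeasurePreserving (fun x => W *ᵥ x) (gam n) (gam n) := by
  have hmeas : Measurable fun x : Fin n → ℝ => W *ᵥ x := by fun_prop
  refine ⟨hmeas, ?_⟩
  have hdet : W.det * W.det = 1 := by
    have := congrArg Matrix.det hW
    simpa using this
  have hdet0 : W.det ≠ 0 := fun h => by simp [h] at hdet
  have habs : |W.det⁻¹| = 1 := by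
    rw [abs_inv, inv_eq_one]
    have : |W.det| * |W.det| = 1 := by rw [abs_mul_abs_self, hdet]
    nlinarith [abs_nonneg W.det]
  have hvol : Measure.map (fun x : Fin n → ℝ => W *ᵥ x) volume = volume := by
    have := Real.map_matrix_volume_pi_eq_smul_volume_pi hdet0
    rw [habs, ENNReal.ofReal_one, one_smul] at this
    exact this
  have hinv : ∀ x, gaussDensity n (W *ᵥ x) = gaussDensity n x := by
    intro x
    have : ∑ i, (W *ᵥ x) i ^ 2 = ∑ i, x i ^ 2 := by
      have h : (W *ᵥ x) ⬝ᵥ (W *ᵥ x) = x ⬝ᵥ x := by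
        rw [Matrix.dotProduct_mulVec, Matrix.vecMul_mulVec, hW, Matrix.vecMul_one]
      simpa [dotProduct, sq] using h
    simp only [gaussDensity, this]
  rw [← withDensity_eq_gam]
  ext s hs
  rw [Measure.map_apply hmeas hs, withDensity_apply _ (hmeas hs), withDensity_apply _ hs]
  conv_rhs => rw [← hvol]
  rw [setLIntegral_map hs (gaussDensity_continuous n).measurable.ennreal_ofReal hmeas]
  simp only [hinv]

lemma sq_integral_le (q : ℝ → ℝ) (hq : Continuous q) (a : ℝ) (ha : 0 < a) :
    (∫ t in (0 : ℝ)..a, q t) ^ 2 ≤ a * ∫ t in (0 : ℝ)..a, q t ^ 2 := by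
  set c := ∫ t in (0 : ℝ)..a, q t with hc
  have h0 : 0 ≤ ∫ t in (0 : ℝ)..a, (q t - c / a) ^ 2 :=
    intervalIntegral.integral_nonneg ha.le fun t _ => sq_nonneg _
  have h1 : ∫ t in (0 : ℝ)..a, (q t - c / a) ^ 2
      = (∫ t in (0 : ℝ)..a, q t ^ 2) - 2 * (c / a) * c + a * (c / a) ^ 2 := by
    have : ∀ t, (q t - c / a) ^ 2 = q t ^ 2 - 2 * (c / a) * q t + (c / a) ^ 2 := fun t => by ring
    simp only [this]
    rw [intervalIntegral.integral_add (Continuous.intervalIntegrable (by fun_prop) _ _) (by simp),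
      intervalIntegral.integral_sub (Continuous.intervalIntegrable (by fun_prop) _ _)
        (Continuous.intervalIntegrable (by fun_prop) _ _),
      intervalIntegral.integral_const_mul, intervalIntegral.integral_const]
    simp [hc]
  rw [h1] at h0
  have h2 : a * ((∫ t in (0 : ℝ)..a, q t ^ 2) - 2 * (c / a) * c + a * (c / a) ^ 2)
      = a * (∫ t in (0 : ℝ)..a, q t ^ 2) - c ^ 2 := by
    field_simp; ring
  nlinarith [mul_nonneg ha.le h0]

lemma memLp_gam (n : ℕ) (f : (Fin n → ℝ) → ℝ) (hf : ContDiff ℝ 1 f)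
    (hsq : ∀ i, Integrable (fun x => (fderiv ℝ f x (Pi.single i 1)) ^ 2) (gam n)) :
    MemLp f 2 (gam n) := by
  set q : (Fin n → ℝ) × (Fin n → ℝ) → ℝ := fun p => fderiv ℝ f p.1 p.2 with hqdef
  have hdf : Continuous (fderiv ℝ f) := hf.continuous_fderiv (by simp)
  have hq : Continuous q := (hdf.comp continuous_fst).clm_apply continuous_snd
  -- `q` is square integrable
  have hqL : MemLp q 2 ((gam n).prod (gam n)) := by
    have h1 : q = fun p => ∑ i, fderiv ℝ f p.1 (Pi.single i 1) * p.2 i := by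
      funext p
      simp only [hqdef]
      conv_lhs => rw [← Finset.univ_sum_single p.2]
      rw [map_sum]
      refine Finset.sum_congr rfl fun i _ => ?_
      rw [mul_comm, ← smul_eq_mul, ← map_smul, ← Pi.single_smul]
      simp
    rw [h1]
    refine memLp_finsetSum _ fun i _ => ?_
    have hc : Continuous fun p : (Fin n → ℝ) × (Fin n → ℝ) =>
        fderiv ℝ f p.1 (Pi.single i 1) * p.2 i := by fun_prop
    rw [memLp_two_iff_integrable_sq hc.aestronglyMeasurable]
    simp only [mul_pow]
    refine (hsq i).mul_prod (g := fun y : Fin n → ℝ => y i ^ 2) ?_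
    have := IsGaussian.memLp_dual (gam n) (ContinuousLinearMap.proj (R := ℝ) (φ := fun _ : Fin n => ℝ) i) 2 (by simp)
    exact this.integrable_sq
  have hqI : Integrable (fun p => q p ^ 2) ((gam n).prod (gam n)) := hqL.integrable_sq
  have hrotc : Continuous fun r : ℝ × ((Fin n → ℝ) × (Fin n → ℝ)) =>
      ContinuousLinearMap.rotation r.1 r.2 := by
    simp only [ContinuousLinearMap.rotation_apply]; fun_prop
  have hmp : ∀ θ : ℝ, MeasurePreserving
      (ContinuousLinearMap.rotation θ : (Fin n → ℝ) × (Fin n → ℝ) →L[ℝ] _)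
      ((gam n).prod (gam n)) ((gam n).prod (gam n)) := fun θ =>
    ⟨by fun_prop, gam_rotation n θ⟩
  set ν : Measure ℝ := volume.restrict (Ioc 0 (Real.pi / 2)) with hν
  have hbig : Integrable (fun r : ℝ × ((Fin n → ℝ) × (Fin n → ℝ)) =>
      q (ContinuousLinearMap.rotation r.1 r.2) ^ 2) (ν.prod ((gam n).prod (gam n))) := by
    have hcont : Continuous (fun r : ℝ × ((Fin n → ℝ) × (Fin n → ℝ)) =>
      q (ContinuousLinearMap.rotation r.1 r.2) ^ 2) := (hq.comp hrotc).pow 2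
    rw [integrable_prod_iff hcont.aestronglyMeasurable]
    constructor
    · exact Filter.Eventually.of_forall fun θ => (hmp θ).integrable_comp_of_integrable hqI
    · have : ∀ θ : ℝ, ∫ p, ‖q (ContinuousLinearMap.rotation θ p) ^ 2‖ ∂((gam n).prod (gam n))
          = ∫ p, ‖q p ^ 2‖ ∂((gam n).prod (gam n)) := by
        intro θ
        conv_rhs => rw [← (hmp θ).map_eq]
        rw [integral_map (by fun_prop) (by fun_prop)]
      simp only [this]
      exact integrable_const _
  have hI := hbig.integral_prod_right
  have hdiff : ∀ p : (Fin n → ℝ) × (Fin n → ℝ),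
      (f p.1 - f p.2) ^ 2 ≤
        Real.pi / 2 * ∫ θ, q (ContinuousLinearMap.rotation θ p) ^ 2 ∂ν := by
    intro p
    have hder : ∀ θ : ℝ, HasDerivAt (fun θ : ℝ => f (Real.cos θ • p.1 + Real.sin θ • p.2))
        (q (ContinuousLinearMap.rotation θ p)) θ := by
      intro θ
      have h1 : HasDerivAt (fun θ : ℝ => Real.cos θ • p.1 + Real.sin θ • p.2)
          (-Real.sin θ • p.1 + Real.cos θ • p.2) θ :=
        ((Real.hasDerivAt_cos θ).smul_const p.1).add ((Real.hasDerivAt_sin θ).smul_const p.2)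
      exact ((hf.differentiable (by simp)) _).hasFDerivAt.comp_hasDerivAt θ h1
    have hrp : Continuous fun θ : ℝ => ContinuousLinearMap.rotation θ p := by
      simp only [ContinuousLinearMap.rotation_apply]; fun_prop
    have hqc : Continuous fun θ : ℝ => q (ContinuousLinearMap.rotation θ p) :=
      hq.comp hrp
    have hftc := intervalIntegral.integral_eq_sub_of_hasDerivAt (a := 0) (b := Real.pi / 2)
      (f := fun θ : ℝ => f (Real.cos θ • p.1 + Real.sin θ • p.2))
      (f' := fun θ : ℝ => q (ContinuousLinearMap.rotation θ p))
      (fun θ _ => hder θ) (hqc.intervalIntegrable _ _)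
    have hle := sq_integral_le (fun θ : ℝ => q (ContinuousLinearMap.rotation θ p)) hqc (Real.pi / 2) (by positivity)
    rw [hftc] at hle
    rw [intervalIntegral.integral_of_le (by positivity)] at hle
    simp only [Real.cos_pi_div_two, Real.sin_pi_div_two, Real.cos_zero, Real.sin_zero, one_smul,
      zero_smul, zero_add, add_zero] at hle
    rw [← neg_sq, neg_sub]
    exact hle
  have hfc := hf.continuous
  have hD : Integrable (fun p : (Fin n → ℝ) × (Fin n → ℝ) => (f p.1 - f p.2) ^ 2)
      ((gam n).prod (gam n)) := by
    refine (hI.const_mul (Real.pi / 2)).mono' ?_ ?_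
    · exact Continuous.aestronglyMeasurable (by fun_prop)
    · refine Filter.Eventually.of_forall fun p => ?_
      rw [Real.norm_of_nonneg (sq_nonneg _)]
      exact hdiff p
  obtain ⟨y, hy⟩ := hD.prod_left_ae.exists
  have h2 : MemLp (fun x => f x - f y) 2 (gam n) :=
    (memLp_two_iff_integrable_sq (Continuous.aestronglyMeasurable (by fun_prop))).2 hy
  have h3 := h2.add (memLp_const (f y))
  convert h3 using 1
  funext x; simp

lemma mc_variance {m N : ℕ} (hN : 1 ≤ N) {Ω : Type*} [MeasurableSpace Ω] (P : Measure Ω)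
    [IsProbabilityMeasure P] (Z : Fin N → Ω → (Fin m → ℝ)) (hZm : ∀ j, Measurable (Z j))
    (hlaw : ∀ j, Measure.map (Z j) P = gam m) (hind : iIndepFun Z P)
    (h : (Fin m → ℝ) → ℝ) (hh : Measurable h) (hL : MemLp h 2 (gam m)) :
    Integrable (fun ω => ((∫ z, h z ∂(gam m)) - (N : ℝ)⁻¹ * ∑ j, h (Z j ω)) ^ 2) P ∧
    ∫ ω, ((∫ z, h z ∂(gam m)) - (N : ℝ)⁻¹ * ∑ j, h (Z j ω)) ^ 2 ∂P =
      (N : ℝ)⁻¹ * ∫ z, (h z - ∫ z, h z ∂(gam m)) ^ 2 ∂(gam m) := by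
  have hN0 : (N : ℝ) ≠ 0 := by positivity
  have hmp : ∀ j, MeasurePreserving (Z j) P (gam m) := fun j => ⟨hZm j, hlaw j⟩
  have hX : ∀ j, MemLp (fun ω => h (Z j ω)) 2 P := fun j => hL.comp_measurePreserving (hmp j)
  have hS : MemLp (fun ω => (N : ℝ)⁻¹ * ∑ j, h (Z j ω)) 2 P :=
    (memLp_finsetSum _ fun j _ => hX j).const_mul _
  have hEX : ∀ j, ∫ ω, h (Z j ω) ∂P = ∫ z, h z ∂(gam m) := by
    intro j
    rw [← hlaw j, integral_map (hZm j).aemeasurable hh.aestronglyMeasurable]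
  have hE : ∫ ω, (N : ℝ)⁻¹ * ∑ j, h (Z j ω) ∂P = ∫ z, h z ∂(gam m) := by
    rw [integral_const_mul, integral_finsetSum _ fun j _ => (hX j).integrable (by simp)]
    simp only [hEX, Finset.sum_const, Finset.card_univ, Fintype.card_fin, nsmul_eq_mul]
    field_simp
  refine ⟨((memLp_const _).sub hS).integrable_sq, ?_⟩
  have hV : ∀ j, Var[fun ω => h (Z j ω); P] = Var[h; gam m] := by
    intro j
    rw [← hlaw j, variance_map hh.aemeasurable (hZm j).aemeasurable]
    rfl
  have h1 : Var[fun ω => (N : ℝ)⁻¹ * ∑ j, h (Z j ω); P] = (N : ℝ)⁻¹ * Var[h; gam m] := by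
    rw [variance_const_mul]
    have h2 := IndepFun.variance_sum (μ := P) (s := Finset.univ)
      (X := fun j ω => h (Z j ω)) (fun j _ => hX j)
      (fun i _ j _ hij => (hind.indepFun hij).comp hh hh)
    have h3 : (∑ j : Fin N, fun ω => h (Z j ω)) = fun ω => ∑ j, h (Z j ω) := by
      funext ω; simp
    rw [h3] at h2
    rw [h2]
    simp only [hV, Finset.sum_const, Finset.card_univ, Fintype.card_fin, nsmul_eq_mul]
    field_simp
  rw [variance_eq_integral hS.aemeasurable, hE, variance_eq_integral hh.aemeasurable] at h1
  rw [← h1]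
  refine integral_congr_ae (Filter.Eventually.of_forall fun ω => ?_)
  simp only
  ring


/-- Unbiased Monte Carlo approximation of the conditional expectation `g` in the
Gaussian case: with i.i.d. samples `Z_j^y` of density `φ_m`, jointly measurable in `(y,ω)`,
and `g_N(y,ω) = (1/N) Σ_j f(W₁y + W₂Z_j^y(ω))`, the expected mean squared error satisfies
`E[∫ (g(y) - g_N(y,·))² ρY(y) dy] = (1/N) ∫ (f(x) - f_g(x))² ρX(x) dx`. -/
theorem monte_carlo_mse_identity
    (k m : ℕ)
    (f : (Fin (k + m) → ℝ) → ℝ)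
    (hf : ContDiff ℝ 1 f)
    (hsq : ∀ i, Integrable fun x =>
      (fderiv ℝ f x (Pi.single i 1)) ^ 2 * gaussDensity (k + m) x)
    (W : Matrix (Fin (k + m)) (Fin (k + m)) ℝ)
    (hW : Wᵀ * W = 1)
    (g : (Fin k → ℝ) → ℝ)
    (hg : ∀ y, g y = ∫ z, f (W.submatrix id (Fin.castAdd m) *ᵥ y +
      W.submatrix id (Fin.natAdd k) *ᵥ z) * gaussDensity m z)
    (Ω : Type*) [MeasurableSpace Ω] (P : Measure Ω) [IsProbabilityMeasure P]
    (N : ℕ) (hN : 1 ≤ N)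
    (Z : Fin N → (Fin k → ℝ) → Ω → (Fin m → ℝ))
    (hZmeas : ∀ j, Measurable fun p : (Fin k → ℝ) × Ω => Z j p.1 p.2)
    (hZlaw : ∀ j y, Measure.map (Z j y) P =
      volume.withDensity fun z => ENNReal.ofReal (gaussDensity m z))
    (hZindep : ∀ y, iIndepFun (fun j => Z j y) P)
    (gN : (Fin k → ℝ) → Ω → ℝ)
    (hgN : ∀ y ω, gN y ω = (N : ℝ)⁻¹ * ∑ j, f (W.submatrix id (Fin.castAdd m) *ᵥ y +
      W.submatrix id (Fin.natAdd k) *ᵥ Z j y ω)) :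
    ∫ ω, (∫ y, (g y - gN y ω) ^ 2 * gaussDensity k y) ∂P =
      (1 / N : ℝ) *
        ∫ x, (f x - g ((W.submatrix id (Fin.castAdd m))ᵀ *ᵥ x)) ^ 2 *
          gaussDensity (k + m) x := by
  have hL := memLp_gam (k + m) f hf (fun i => (integrable_gam _ _).1 (hsq i))
  have hfc := hf.continuous
  set T : (Fin k → ℝ) × (Fin m → ℝ) → (Fin (k + m) → ℝ) := fun p =>
    W.submatrix id (Fin.castAdd m) *ᵥ p.1 + W.submatrix id (Fin.natAdd k) *ᵥ p.2 with hT
  have hTW : T = fun p => W *ᵥ (Fin.append p.1 p.2 : Fin (k + m) → ℝ) := by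
    funext p i
    simp [hT, mulVec, dotProduct, Fin.sum_univ_add]
  have hTmp : MeasurePreserving T ((gam k).prod (gam m)) (gam (k + m)) := by
    rw [hTW]
    exact (gam_orth _ W hW).comp (gam_append k m)
  have hTc : Continuous T := by fun_prop
  have hproj : ∀ p, (W.submatrix id (Fin.castAdd m))ᵀ *ᵥ T p = p.1 := by
    intro p
    have h1 : Wᵀ *ᵥ T p = (Fin.append p.1 p.2 : Fin (k + m) → ℝ) := by
      rw [hTW, Matrix.mulVec_mulVec, hW, Matrix.one_mulVec]
    funext i
    have h2 := congrFun h1 (Fin.castAdd m i)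
    rw [Fin.append_left] at h2
    exact h2
  have hFc : Continuous fun p => f (T p) := hfc.comp hTc
  have hFL : MemLp (fun p => f (T p)) 2 ((gam k).prod (gam m)) := hL.comp_measurePreserving hTmp
  have hg' : ∀ y, g y = ∫ z, f (T (y, z)) ∂(gam m) := fun y => by
    rw [hg y, integral_gam m (fun z => f (T (y, z)))]
  have hgm : StronglyMeasurable g := by
    have : g = fun y => ∫ z, f (T (y, z)) ∂(gam m) := funext hg'
    rw [this]
    exact hFc.stronglyMeasurable.integral_prod_right
  have hFsq := hFL.integrable_sq
  have hFy : ∀ᵐ y ∂(gam k), MemLp (fun z => f (T (y, z))) 2 (gam m) := by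
    filter_upwards [hFsq.prod_right_ae] with y hy
    exact (memLp_two_iff_integrable_sq (Continuous.aestronglyMeasurable (by fun_prop))).2 hy
  have hgL : MemLp g 2 (gam k) := by
    rw [memLp_two_iff_integrable_sq hgm.aestronglyMeasurable]
    refine hFsq.integral_prod_left.mono' (hgm.aestronglyMeasurable.pow 2) ?_
    filter_upwards [hFy] with y hy
    rw [Real.norm_of_nonneg (sq_nonneg _)]
    have h1 := variance_nonneg (fun z => f (T (y, z))) (gam m)
    rw [variance_eq_sub hy, ← hg' y] at h1
    have h2 : ∫ z, f (T (y, z)) ^ 2 ∂(gam m) = (gam m)[(fun z => f (T (y, z))) ^ 2] := rfl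
    linarith
  have hdiffL : MemLp (fun p : (Fin k → ℝ) × (Fin m → ℝ) => f (T p) - g p.1) 2
      ((gam k).prod (gam m)) := hFL.sub (hgL.comp_measurePreserving measurePreserving_fst)
  have hdI := hdiffL.integrable_sq
  have hvar : ∀ᵐ y ∂(gam k), Integrable (fun ω => (g y - gN y ω) ^ 2) P ∧
      ∫ ω, (g y - gN y ω) ^ 2 ∂P = (N : ℝ)⁻¹ * ∫ z, (f (T (y, z)) - g y) ^ 2 ∂(gam m) := by
    filter_upwards [hFy] with y hy
    have := mc_variance hN P (fun j => Z j y)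
      (fun j => (hZmeas j).comp measurable_prodMk_left)
      (fun j => by rw [hZlaw j y, withDensity_eq_gam]) (hZindep y)
      (fun z => f (T (y, z))) (Continuous.measurable (by fun_prop)) hy
    rw [← hg' y] at this
    simp only [hgN]
    exact this
  have hgNm : Measurable fun p : (Fin k → ℝ) × Ω => gN p.1 p.2 := by
    simp only [hgN]
    refine Measurable.const_mul (Finset.measurable_fun_sum _ fun j _ => ?_) _
    exact hFc.measurable.comp (measurable_fst.prodMk (hZmeas j))
  have hI : Integrable (fun p : (Fin k → ℝ) × Ω => (g p.1 - gN p.1 p.2) ^ 2)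
      ((gam k).prod P) := by
    have hm : Measurable (fun p : (Fin k → ℝ) × Ω => (g p.1 - gN p.1 p.2) ^ 2) :=
      ((hgm.measurable.comp measurable_fst).sub hgNm).pow_const 2
    rw [integrable_prod_iff hm.aestronglyMeasurable]
    refine ⟨hvar.mono fun y hy => hy.1, ?_⟩
    refine (hdI.integral_prod_left.const_mul (N : ℝ)⁻¹).congr ?_
    filter_upwards [hvar] with y hy
    simp only [Real.norm_of_nonneg (sq_nonneg _)]
    exact hy.2.symm
  have hL1 : ∀ ω, ∫ y, (g y - gN y ω) ^ 2 * gaussDensity k y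
      = ∫ y, (g y - gN y ω) ^ 2 ∂(gam k) := fun ω =>
    integral_gam k fun y => (g y - gN y ω) ^ 2
  simp only [hL1]
  rw [integral_gam (k + m)
    (fun x => (f x - g ((W.submatrix id (Fin.castAdd m))ᵀ *ᵥ x)) ^ 2)]
  rw [← integral_integral_swap (f := fun y ω => (g y - gN y ω) ^ 2) hI]
  rw [integral_congr_ae (hvar.mono fun y hy => hy.2), integral_const_mul, one_div]
  congr 1
  rw [← hTmp.map_eq, integral_map hTc.aemeasurable]
  · simp only [hproj]
    rw [integral_prod _ hdI]
  · refine Measurable.aestronglyMeasurable ?_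
    have hp : Measurable fun x : Fin (k + m) → ℝ =>
        (W.submatrix id (Fin.castAdd m))ᵀ *ᵥ x := by fun_prop
    exact (hfc.measurable.sub (hgm.measurable.comp hp)).pow_const 2
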